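/- arXiv:2212.13749 — 2 statements merged into one kernel-verified Lean document; each statement's English description precedes it below -/
import Mathlib

section
/- Let G be a finite simple graph with edge set E. The set of extreme points of the matching polyhedron P(G) ⊆ ℝ^E is exactly the set of indicator vectors of matchings of G, i.e., extremePoints(P(G)) = { χ_M : M is a matching of G }. -/
open scoped symmDiff
open Classical

noncomputable section

variable {V : Type*}

/-- A matching of `G`: a set of edges of `G`, no two of which share a vertex. -/
def IsMatchingOf (G : SimpleGraph V) (M : Set (Sym2 V)) : Prop :=
  M ⊆ G.edgeSet ∧ ∀ e ∈ M, ∀ f ∈ M, e ≠ f → ∀ v : V, ¬(v ∈ e ∧ v ∈ f)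

/-- The indicator vector `χ_M ∈ ℝ^E` of a set `M` of edges. -/
def chi (G : SimpleGraph V) (M : Set (Sym2 V)) : G.edgeSet → ℝ :=
  fun e => if (e : Sym2 V) ∈ M then 1 else 0

/-- The standard inner product `⟨a, x⟩ = Σ_{e ∈ E} a_e x_e` on `ℝ^E`. -/
def dot (G : SimpleGraph V) [Fintype G.edgeSet] (a x : G.edgeSet → ℝ) : ℝ :=
  ∑ e, a e * x e

/-- `p` is a (nonempty) simple path, or a simple cycle of even length. -/
def IsSimplePathOrEvenCycle (G : SimpleGraph V) {u v : V} (p : G.Walk u v) : Prop :=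
  (p.IsPath ∧ 0 < p.length) ∨ ∃ h : v = u, (p.copy rfl h).IsCycle ∧ Even p.length

/-- `A` is the edge set of a simple path, or of a simple cycle of even length, in `G`. -/
def IsPathOrEvenCycleEdgeSet (G : SimpleGraph V) (A : Set (Sym2 V)) : Prop :=
  ∃ (u v : V) (p : G.Walk u v), IsSimplePathOrEvenCycle G p ∧ A = {e | e ∈ p.edges}

/-- Two matchings are adjacent if their symmetric difference is the edge set of a
simple path or of a simple cycle of even length. -/
def AdjacentMatchings (G : SimpleGraph V) (M1 M2 : Set (Sym2 V)) : Prop :=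
  IsMatchingOf G M1 ∧ IsMatchingOf G M2 ∧ IsPathOrEvenCycleEdgeSet G (M1 ∆ M2)

/-- The alternating sum `a e₁ - a e₂ + a e₃ - ⋯` over a list. -/
def altSum {α : Type*} (a : α → ℝ) : List α → ℝ
  | [] => 0
  | e :: l => a e - altSum a l

/-- Extension by zero of a vector `ℝ^E` to all of `Sym2 V`. -/
def extendE (G : SimpleGraph V) (a : G.edgeSet → ℝ) : Sym2 V → ℝ :=
  fun e => if h : e ∈ G.edgeSet then a ⟨e, h⟩ else 0

/-- `a` lies on no hyperplane of the matching arrangement `MA(G)`: every alternating sum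
along a simple path or an even simple cycle is nonzero. -/
def OffHyperplanes (G : SimpleGraph V) (a : G.edgeSet → ℝ) : Prop :=
  ∀ ⦃u v : V⦄ (p : G.Walk u v), IsSimplePathOrEvenCycle G p →
    altSum (extendE G a) p.edges ≠ 0

/-- `a` and `b` induce the same orientation on adjacent pairs of matchings. -/
def SameOrientation (G : SimpleGraph V) [Fintype G.edgeSet] (a b : G.edgeSet → ℝ) : Prop :=
  ∀ M1 M2 : Set (Sym2 V), AdjacentMatchings G M1 M2 →
    (dot G a (chi G M1) < dot G a (chi G M2) ↔ dot G b (chi G M1) < dot G b (chi G M2))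

/-- The matching polyhedron `P(G) ⊆ ℝ^E` of Edmonds. -/
def matchingPolyhedron (G : SimpleGraph V) [Fintype V] [Fintype G.edgeSet] :
    Set (G.edgeSet → ℝ) :=
  {x | (∀ e, 0 ≤ x e) ∧
       (∀ v : V, (∑ e : G.edgeSet, if v ∈ (e : Sym2 V) then x e else 0) ≤ 1) ∧
       ∀ (S : Finset V) (k : ℕ), S.card = 2 * k + 1 →
         (∑ e : G.edgeSet, if ∀ w ∈ (e : Sym2 V), w ∈ S then x e else 0) ≤ (k : ℝ)}

/-- The function `a` induces the relation `O` on adjacent matchings. -/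
def Induces (G : SimpleGraph V) [Fintype G.edgeSet] (a : G.edgeSet → ℝ)
    (O : Set (Sym2 V) → Set (Sym2 V) → Prop) : Prop :=
  ∀ M1 M2 : Set (Sym2 V), AdjacentMatchings G M1 M2 →
    (O M1 M2 ↔ dot G a (chi G M1) < dot G a (chi G M2))

/-- `O` is an LP-orientation: a relation on pairs of adjacent matchings induced by
some `a ∈ ℝ^E` lying on no hyperplane of `MA(G)`. -/
def IsLPOrientation (G : SimpleGraph V) [Fintype G.edgeSet]
    (O : Set (Sym2 V) → Set (Sym2 V) → Prop) : Prop :=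
  (∀ M1 M2, O M1 M2 → AdjacentMatchings G M1 M2) ∧
  ∃ a : G.edgeSet → ℝ, OffHyperplanes G a ∧ Induces G a O

namespace EdmondsMP

/-- Twice the weight of the matching given by an involution. -/
def val [Fintype V] (w : V → V → ℕ) (f : V → V) : ℕ := ∑ v, w v (f v)

/-- all nontrivial pairs of `f` have positive weight -/
def Ok (w : V → V → ℕ) (f : V → V) : Prop := ∀ v, f v = v ∨ 0 < w v (f v)

theorem val_even [Fintype V] {w : V → V → ℕ} (hs : ∀ u v, w u v = w v u) (hd : ∀ v, w v v = 0)
    {f : V → V} (hf : ∀ v, f (f v) = v) : 2 ∣ val w f := by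
  rw [← ZMod.natCast_eq_zero_iff]
  unfold val
  push_cast
  refine Finset.sum_involution (fun v _ => f v) ?_ ?_ (by simp) (by simp [hf])
  · intro v _
    rw [hf, hs (f v) v]
    exact CharTwo.add_self_eq_zero _
  · intro v _ h e
    apply h
    rw [e, hd]
    simp

theorem okify [Fintype V] {w : V → V → ℕ} (hs : ∀ u v, w u v = w v u) (hd : ∀ v, w v v = 0)
    {f : V → V} (hf : ∀ v, f (f v) = v) :
    ∃ g : V → V, (∀ v, g (g v) = v) ∧ Ok w g ∧ val w g = val w f ∧
      ∀ v, w v (f v) = 0 → g v = v := by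
  refine ⟨fun v => if w v (f v) = 0 then v else f v, ?_, ?_, ?_, ?_⟩
  · intro v
    by_cases h : w v (f v) = 0
    · simp [h]
    · have : w (f v) v ≠ 0 := by rwa [hs]
      simp [h, hf, this]
  · intro v
    by_cases h : w v (f v) = 0
    · simp [h]
    · right; simp only [h, if_false]; omega
  · unfold val
    refine Finset.sum_congr rfl fun v _ => ?_
    by_cases h : w v (f v) = 0
    · simp [h, hd]
    · simp [h]
  · intro v h
    simp [h]

theorem orbit [Fintype V] {f g : V → V} (t : V)
    (hf : ∀ v, f (f v) = v) (hg : ∀ v, g (g v) = v) :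
    ∃ K : Finset V, t ∈ K ∧ (∀ v ∈ K, f v ∈ K) ∧ (∀ v ∈ K, g v ∈ K) ∧
      (∑ v ∈ K, ((if f v = v then 1 else 0) + (if g v = v then 1 else 0)) ≤ 2) ∧
      ∀ C : Set V, t ∈ C → (∀ v ∈ C, f v ∈ C) → (∀ v ∈ C, g v ∈ C) → ∀ v ∈ K, v ∈ C := by
  let L : SimpleGraph V :=
    { Adj := fun a b => a ≠ b ∧ (b = f a ∨ b = g a)
      symm := ⟨by
        rintro a b ⟨h, h' | h'⟩
        · exact ⟨h.symm, Or.inl (by rw [h', hf])⟩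
        · exact ⟨h.symm, Or.inr (by rw [h', hg])⟩⟩
      loopless := ⟨fun a h => h.1 rfl⟩ }
  let c := L.connectedComponentMk t
  have hcl : ∀ a b, L.Adj a b → a ∈ c.supp → b ∈ c.supp := by
    intro a b hab ha
    exact (c.mem_supp_congr_adj hab).1 ha
  have hcf : ∀ v ∈ c.supp, f v ∈ c.supp := by
    intro v hv
    by_cases h : f v = v
    · rwa [h]
    · exact hcl v _ ⟨fun e => h e.symm, Or.inl rfl⟩ hv
  have hcg : ∀ v ∈ c.supp, g v ∈ c.supp := by
    intro v hv
    by_cases h : g v = v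
    · rwa [h]
    · exact hcl v _ ⟨fun e => h e.symm, Or.inr rfl⟩ hv
  refine ⟨c.supp.toFinset, ?_, ?_, ?_, ?_, ?_⟩
  · simp [c]
  · intro v hv; rw [Set.mem_toFinset] at *; exact hcf v hv
  · intro v hv; rw [Set.mem_toFinset] at *; exact hcg v hv
  · have hconn : (L.induce c.supp).Connected := c.connected_toSimpleGraph
    have h1 := hconn.card_vert_le_card_edgeSet_add_one
    have h2 := (L.induce c.supp).sum_degrees_eq_twice_card_edges
    rw [Nat.card_eq_fintype_card, Nat.card_eq_fintype_card, ← SimpleGraph.edgeFinset_card] at h1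
    have h3 : ∀ v : c.supp, (L.induce c.supp).degree v + ((if f v = v then 1 else 0) +
        (if g v = v then 1 else 0)) ≤ 2 := by
      intro v
      have hsub : ((L.induce c.supp).neighborFinset v).map (Function.Embedding.subtype _) ⊆
          ({f v.1, g v.1} : Finset V).erase v.1 := by
        intro b hb
        simp only [Finset.mem_map, SimpleGraph.mem_neighborFinset] at hb
        obtain ⟨b, hb, rfl⟩ := hb
        have hb : L.Adj v.1 b.1 := hb
        simp only [Finset.mem_erase, Finset.mem_insert, Finset.mem_singleton]
        exact ⟨hb.1.symm, hb.2⟩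
      have hc := Finset.card_le_card hsub
      rw [Finset.card_map, SimpleGraph.card_neighborFinset_eq_degree] at hc
      have hgen : (({f v.1, g v.1} : Finset V).erase v.1).card + ((if f v = v.1 then 1 else 0) +
        (if g v = v.1 then 1 else 0)) ≤ 2 := by
        by_cases a1 : f v = v.1 <;> by_cases a2 : g v = v.1
        · simp [a1, a2]
        · have : (({f v.1, g v.1} : Finset V).erase v.1) ⊆ {g v.1} := by
            intro z; simp only [Finset.mem_erase, Finset.mem_insert, Finset.mem_singleton, a1]; tauto
          have := Finset.card_le_card this
          simp only [Finset.card_singleton] at this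
          simp only [a1, a2, if_true, if_false] at this ⊢; omega
        · have : (({f v.1, g v.1} : Finset V).erase v.1) ⊆ {f v.1} := by
            intro z; simp only [Finset.mem_erase, Finset.mem_insert, Finset.mem_singleton, a2]; tauto
          have := Finset.card_le_card this
          simp only [Finset.card_singleton] at this
          simp only [a1, a2, if_true, if_false] at this ⊢; omega
        · have h4 := Finset.card_le_card (Finset.erase_subset v.1 ({f v.1, g v.1} : Finset V))
          have h5 : ({f v.1, g v.1} : Finset V).card ≤ 2 := Finset.card_le_two
          simp only [a1, a2, if_false]; omega
      omega
    have h4 := Finset.sum_le_sum (fun v (_ : v ∈ (Finset.univ : Finset c.supp)) => h3 v)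
    rw [Finset.sum_add_distrib] at h4
    simp only [Finset.sum_const, Finset.card_univ, smul_eq_mul] at h4
    have h5 : ∑ v ∈ c.supp.toFinset, ((if f v = v then 1 else 0) + (if g v = v then 1 else 0)) =
        ∑ v : c.supp, ((if f v = v.1 then 1 else 0) + (if g v = v.1 then 1 else 0)) := by
      rw [← Finset.sum_coe_sort]
      refine Fintype.sum_equiv (Equiv.subtypeEquivRight (by simp)) _ _ ?_
      intro x; rfl
    rw [h5]
    omega
  · intro C ht h1 h2 v hv
    rw [Set.mem_toFinset] at hv
    have hr : L.Reachable t v := (SimpleGraph.ConnectedComponent.exact hv).symm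
    obtain ⟨p⟩ := hr
    clear hv
    have key : ∀ a b (p : L.Walk a b), a ∈ C → b ∈ C := by
      intro a b p
      induction p with
      | nil => exact id
      | cons h _ ih =>
        intro ha
        apply ih
        rcases h.2 with e | e
        · rw [e]; exact h1 _ ha
        · rw [e]; exact h2 _ ha
    exact key _ _ p ht

/-- number of vertices of `C` fixed by `f` -/
def miss (C : Finset V) (f : V → V) : ℕ := ∑ v ∈ C, if f v = v then 1 else 0

theorem miss_split (C K : Finset V) (hK : K ⊆ C) (f : V → V) :
    miss C f = miss (C \ K) f + miss K f := by
  unfold miss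
  rw [Finset.sum_sdiff hK]

theorem bump [Fintype V] {w : V → V → ℕ} (hs : ∀ u v, w u v = w v u) (hd : ∀ v, w v v = 0)
    (hmiss : ∀ t, ∃ N : V → V, (∀ v, N (N v) = v) ∧ Ok w N ∧ N t = t ∧
      ∀ f : V → V, (∀ v, f (f v) = v) → val w f ≤ val w N) {a b : V} (hab : 0 < w a b) :
    ∃ C : Finset V, a ∈ C ∧ b ∈ C ∧ ∃ f : V → V, (∀ v, f (f v) = v) ∧
      ∀ g : V → V, (∀ v, g (g v) = v) →
        val (fun u v => w u v - if u ∈ C ∧ v ∈ C then 1 else 0) g + 2 * (C.card / 2)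
          ≤ val w f := by
  let H : SimpleGraph V :=
    { Adj := fun u v => 0 < w u v
      symm := ⟨fun u v h => by rw [hs]; exact h⟩
      loopless := ⟨fun u h => by rw [hd] at h; exact lt_irrefl _ h⟩ }
  have hHadj : ∀ u v, H.Adj u v ↔ 0 < w u v := fun u v => Iff.rfl
  let C : Finset V := Finset.univ.filter (fun v => H.Reachable a v)
  have hC : ∀ v, v ∈ C ↔ H.Reachable a v := by intro v; simp [C]
  have hCcl : ∀ u v, 0 < w u v → u ∈ C → v ∈ C := by
    intro u v h hu
    rw [hC] at *
    exact hu.trans (SimpleGraph.Adj.reachable ((hHadj u v).2 h))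
  have haC : a ∈ C := by rw [hC]
  have hCok : ∀ f, Ok w f → ∀ v ∈ C, f v ∈ C := by
    intro f hf v hv
    rcases hf v with h | h
    · rwa [h]
    · exact hCcl _ _ h hv
  refine ⟨C, haC, hCcl _ _ hab haC, ?_⟩
  set w' : V → V → ℕ := fun u v => w u v - if u ∈ C ∧ v ∈ C then 1 else 0 with hw'
  have hs' : ∀ u v, w' u v = w' v u := by
    intro u v; simp only [hw', hs u v, and_comm]
  have hd' : ∀ v, w' v v = 0 := by intro v; simp [hw', hd]
  have hval : ∀ f, Ok w f → val w f + miss C f = val w' f + C.card := by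
    intro f hf
    have h1 : miss C f = ∑ v, if v ∈ C then (if f v = v then 1 else 0) else 0 := by
      rw [miss, Finset.sum_ite_mem, Finset.univ_inter]
    have h2 : C.card = ∑ v, if v ∈ C then 1 else 0 := by simp
    rw [h1, h2, val, val, ← Finset.sum_add_distrib, ← Finset.sum_add_distrib]
    refine Finset.sum_congr rfl fun v _ => ?_
    by_cases hv : v ∈ C
    · have hfv := hCok f hf v hv
      by_cases e : f v = v
      · simp [e, hd, hd', hv]
      · have h0 : 0 < w v (f v) := (hf v).resolve_left e
        simp only [hw', hv, hfv, e, if_true, if_false, and_self]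
        omega
    · simp [hw', hv]
  let A : Finset (V → V) := Finset.univ.filter (fun f => (∀ v, f (f v) = v) ∧ Ok w f)
  have hA : ∀ f, f ∈ A ↔ (∀ v, f (f v) = v) ∧ Ok w f := by intro f; simp [A]
  have hAne : A.Nonempty := ⟨id, by rw [hA]; exact ⟨fun _ => rfl, fun _ => Or.inl rfl⟩⟩
  obtain ⟨f0, hf0, hf0max⟩ := Finset.exists_max_image A (val w') hAne
  have hA2 : (A.filter (fun f => val w' f = val w' f0)).Nonempty :=
    ⟨f0, by simp [hf0]⟩
  obtain ⟨f1, hf1, hf1min⟩ := Finset.exists_min_image _ (miss C) hA2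
  have key : ∀ d : ℕ, ∀ f ∈ A, val w' f = val w' f0 → miss C f = miss C f1 →
      ∀ u ∈ C, ∀ v ∈ C, u ≠ v → f u = u → f v = v → H.dist u v = d → False := by
    intro d
    induction d using Nat.strong_induction_on with
    | _ d ih =>
    intro f hfA hfv hfm u hu v hv huv hfu hfvv hdist
    have hreach : H.Reachable u v := ((hC u).1 hu).symm.trans ((hC v).1 hv)
    obtain ⟨p, hp⟩ := hreach.exists_walk_length_eq_dist
    cases p with
    | nil => exact huv rfl
    | @cons _ t _ hut q =>
    have hut' : 0 < w u t := hut
    have htC : t ∈ C := hCcl _ _ hut' hu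
    have htu : t ≠ u := fun e => by rw [e, hd] at hut'; exact lt_irrefl _ hut'
    obtain ⟨hfi, hfok⟩ := (hA f).1 hfA
    by_cases htv : t = v
    ·
      subst htv
      let g : V → V := fun z => if z = u then t else if z = t then u else f z
      have hgi : ∀ z, g (g z) = z := by
        intro z
        by_cases h1 : z = u
        · simp [g, h1, htu]
        · by_cases h2 : z = t
          · simp [g, h2, htu]
          · have h3 : f z ≠ u := fun e => h1 (by rw [← hfi z, e, hfu])
            have h4 : f z ≠ t := fun e => h2 (by rw [← hfi z, e, hfvv])
            simp [g, h1, h2, h3, h4, hfi]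
      have hgok : Ok w g := by
        intro z
        by_cases h1 : z = u
        · right; simp [g, h1, hut']
        · by_cases h2 : z = t
          · right; simp [g, h2, htu]; rw [hs]; exact hut'
          · simp only [g, h1, h2, if_false]; exact hfok z
      have hgA : g ∈ A := (hA g).2 ⟨hgi, hgok⟩
      have h1 : val w' f ≤ val w' g := by
        refine Finset.sum_le_sum fun z _ => ?_
        by_cases h1 : z = u
        · rw [h1, hfu, hd']; exact Nat.zero_le _
        · by_cases h2 : z = t
          · rw [h2, hfvv, hd']; exact Nat.zero_le _
          · simp [g, h1, h2]
      have h2 : val w' g = val w' f0 := le_antisymm (hf0max g hgA) (hfv ▸ h1)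
      have h3 := hf1min g (by simp [hgA, h2])
      have h4 : miss C g < miss C f := by
        refine Finset.sum_lt_sum (fun z _ => ?_) ⟨u, hu, ?_⟩
        · by_cases h1 : z = u
          · simp [g, h1, htu]
          · by_cases h2 : z = t
            · simp [g, h2, htu, htu.symm]
            · simp [g, h1, h2]
        · simp [g, htu, hfu]
      omega
    ·
      have hqlen : H.dist t v ≤ q.length := SimpleGraph.dist_le q
      rw [SimpleGraph.Walk.length_cons] at hp
      have hd1 : H.dist t v < d := by omega
      have hq0 : 0 < q.length := by
        rcases Nat.eq_zero_or_pos q.length with h | h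
        · exact absurd (SimpleGraph.Walk.eq_of_length_eq_zero h) htv
        · exact h
      have hd2 : H.dist u t < d := by
        have : H.dist u t ≤ 1 := by
          have := SimpleGraph.dist_le (SimpleGraph.Walk.cons hut SimpleGraph.Walk.nil)
          simpa using this
        omega
      obtain ⟨N, hNi, hNok, hNt, hNmax⟩ := hmiss t
      obtain ⟨K, htK, hKf, hKN, hK2, hKsub⟩ := orbit t hfi hNi
      have hKC : K ⊆ C := fun z hz =>
        hKsub (fun z => z ∈ C) htC (hCok f hfok) (hCok N hNok) z hz
      have hswap : ∀ g h : V → V, (∀ z, g (g z) = z) → (∀ z, h (h z) = z) → Ok w g → Ok w h →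
          (∀ z ∈ K, g z ∈ K) → (∀ z ∈ K, h z ∈ K) →
          (∀ z, (fun z => if z ∈ K then g z else h z) ((fun z => if z ∈ K then g z else h z) z) = z)
          ∧ Ok w (fun z => if z ∈ K then g z else h z) := by
        intro g h hgi hhi hgo hho hgK hhK
        constructor
        · intro z
          by_cases hz : z ∈ K
          · simp [hz, hgK z hz, hgi]
          · have : h z ∉ K := fun e => hz (by have := hhK _ e; rwa [hhi] at this)
            simp [hz, this, hhi]
        · intro z
          by_cases hz : z ∈ K
          · simp only [hz, if_true]; exact hgo z
          · simp only [hz, if_false]; exact hho z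
      obtain ⟨h1i, h1o⟩ := hswap N f hNi hfi hNok hfok hKN hKf
      obtain ⟨h2i, h2o⟩ := hswap f N hfi hNi hfok hNok hKf hKN
      set f' : V → V := fun z => if z ∈ K then N z else f z with hf'
      set N' : V → V := fun z => if z ∈ K then f z else N z with hN'
      have hsum : val w f' + val w N' = val w f + val w N := by
        rw [val, val, val, val, ← Finset.sum_add_distrib, ← Finset.sum_add_distrib]
        refine Finset.sum_congr rfl fun z _ => ?_
        by_cases hz : z ∈ K
        · simp [hf', hN', hz, add_comm]
        · simp [hf', hN', hz]
      have hN'le := hNmax N' h2i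
      have hf'A : f' ∈ A := (hA f').2 ⟨h1i, h1o⟩
      have e1 := hval f hfok
      have e2 := hval f' h1o
      have m1 := miss_split C K hKC f
      have m2 := miss_split C K hKC f'
      have m3 : miss (C \ K) f' = miss (C \ K) f := by
        refine Finset.sum_congr rfl fun z hz => ?_
        have : z ∉ K := (Finset.mem_sdiff.1 hz).2
        simp [hf', this]
      have m4 : miss K f' = miss K N := by
        refine Finset.sum_congr rfl fun z hz => ?_
        simp [hf', hz]
      have m5 : miss K f + miss K N ≤ 2 := by
        rw [miss, miss, ← Finset.sum_add_distrib]; exact hK2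
      have m6 : 1 ≤ miss K N := by
        have := Finset.single_le_sum (f := fun z => if N z = z then 1 else 0)
          (fun z _ => Nat.zero_le _) htK
        simpa [hNt, miss] using this
      have m7 := hf0max f' hf'A
      have o1 : val w' f' = val w' f0 := by omega
      have o2 : miss C f' = miss C f1 := by omega
      have hf't : f' t = t := by simp [hf', htK, hNt]
      by_cases huK : u ∈ K
      · by_cases hvK : v ∈ K
        · have : 2 ≤ miss K f := by
            have hsub : ({u, v} : Finset V) ⊆ K := by
              intro z hz
              simp only [Finset.mem_insert, Finset.mem_singleton] at hz
              rcases hz with rfl | rfl <;> assumption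
            have := Finset.sum_le_sum_of_subset (f := fun z => if f z = z then 1 else 0) hsub
            rw [Finset.sum_pair huv] at this
            simpa [hfu, hfvv, miss] using this
          omega
        · exact ih _ hd1 f' hf'A o1 o2 t htC v hv htv hf't (by simp [hf', hvK, hfvv]) rfl
      · exact ih _ hd2 f' hf'A o1 o2 u hu t htC htu.symm (by simp [hf', huK, hfu]) hf't rfl
  simp only [Finset.mem_filter] at hf1
  obtain ⟨hf1A, hf1v⟩ := hf1
  obtain ⟨hf1i, hf1o⟩ := (hA f1).1 hf1A
  have hle1 : miss C f1 ≤ 1 := by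
    have : miss C f1 = (C.filter (fun v => f1 v = v)).card := by
      rw [miss, Finset.card_filter]
    rw [this, Finset.card_le_one]
    intro u hu v hv
    simp only [Finset.mem_filter] at hu hv
    by_contra huv
    exact key _ f1 hf1A hf1v rfl u hu.1 v hv.1 huv hu.2 hv.2 rfl
  refine ⟨f1, hf1i, ?_⟩
  intro g hg
  obtain ⟨g', hg'i, hg'o, hg'v, -⟩ := okify hs' hd' hg
  have hg'A : g' ∈ A := (hA g').2 ⟨hg'i, fun z => (hg'o z).imp id (fun h => lt_of_lt_of_le h (Nat.sub_le _ _))⟩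
  have h1 := hf0max g' hg'A
  have h2 := hval f1 hf1o
  have h3 := val_even hs hd hf1i
  have h4 := val_even hs' hd' hf1i
  omega

theorem core [Fintype V] (x : V → V → ℝ) (hx0 : ∀ u v, 0 ≤ x u v) (hxs : ∀ u v, x u v = x v u)
    (hx1 : ∀ v, ∑ u, x v u ≤ 1)
    (hxS : ∀ (S : Finset V) (k : ℕ), S.card = 2 * k + 1 →
      ∑ u ∈ S, ∑ v ∈ S, x u v ≤ 2 * k) :
    ∀ (n : ℕ) (w : V → V → ℕ), (∀ u v, w u v = w v u) → (∀ v, w v v = 0) →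
      ∑ u, ∑ v, w u v = n →
      ∃ f : V → V, (∀ v, f (f v) = v) ∧ ∑ u, ∑ v, (w u v : ℝ) * x u v ≤ val w f := by
  intro n
  induction n using Nat.strong_induction_on with
  | _ n ih =>
  intro w hs hd hn
  by_cases hw0 : ∀ u v, w u v = 0
  · exact ⟨id, fun _ => rfl, by simp [hw0]⟩
  push Not at hw0
  obtain ⟨a, b, hab⟩ := hw0
  let I : Finset (V → V) := Finset.univ.filter (fun f => ∀ v, f (f v) = v)
  have hI : ∀ f, f ∈ I ↔ ∀ v, f (f v) = v := by intro f; simp [I]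
  obtain ⟨m, hm, hmax⟩ := Finset.exists_max_image I (val w) ⟨id, by rw [hI]; exact fun _ => rfl⟩
  have hmi := (hI m).1 hm
  have hlt : ∀ w' : V → V → ℕ, (∀ u v, w' u v ≤ w u v) → (∃ u v, w' u v < w u v) →
      ∑ u, ∑ v, w' u v < n := by
    rintro w' h1 ⟨u, v, h2⟩
    rw [← hn]
    refine Finset.sum_lt_sum (fun u _ => Finset.sum_le_sum fun v _ => h1 u v) ⟨u, Finset.mem_univ _, ?_⟩
    exact Finset.sum_lt_sum (fun v _ => h1 u v) ⟨v, Finset.mem_univ _, h2⟩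
  by_cases hcase : ∃ u, ∀ f : V → V, (∀ v, f (f v) = v) → val w f = val w m → 0 < w u (f u)
  · obtain ⟨u, hu⟩ := hcase
    let w' : V → V → ℕ := fun p q => w p q - if p = u ∨ q = u then 1 else 0
    have hs' : ∀ p q, w' p q = w' q p := by intro p q; simp only [w', hs p q, or_comm]
    have hd' : ∀ v, w' v v = 0 := by intro v; simp [w', hd]
    have hle : ∀ p q, w' p q ≤ w p q := fun p q => Nat.sub_le _ _
    have hum := hu m hmi rfl
    obtain ⟨f, hfi, hf⟩ := ih _ (hlt w' hle ⟨u, m u, by simp [w']; omega⟩) w' hs' hd' rfl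
    have hstep : ∑ p, ∑ q, (w p q : ℝ) * x p q ≤ ∑ p, ∑ q, (w' p q : ℝ) * x p q + 2 := by
      have h1 : ∀ p q, (w p q : ℝ) * x p q ≤ (w' p q : ℝ) * x p q +
          ((if p = u then x u q else 0) + (if q = u then x u p else 0)) := by
        intro p q
        have hc : (w p q : ℝ) ≤ (w' p q : ℝ) + (if p = u then 1 else 0) + (if q = u then 1 else 0) := by
          have : w p q ≤ w' p q + (if p = u then 1 else 0) + (if q = u then 1 else 0) := by
            simp only [w']; split_ifs <;> first | omega | tauto
          exact_mod_cast this
        have := mul_le_mul_of_nonneg_right hc (hx0 p q)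
        refine this.trans (le_of_eq ?_)
        by_cases h1 : p = u <;> by_cases h2 : q = u
        · subst h1; subst h2; simp; ring
        · subst h1; simp [h2]; ring
        · subst h2; simp [h1, hxs p q]; ring
        · simp [h1, h2]
      refine (Finset.sum_le_sum fun p _ => Finset.sum_le_sum fun q _ => h1 p q).trans ?_
      simp only [Finset.sum_add_distrib]
      have h2 : ∑ p, ∑ q, (if p = u then x u q else 0) = ∑ q, x u q := by
        rw [Finset.sum_comm]; simp
      have h3 : ∑ p, ∑ q, (if q = u then x u p else 0) = ∑ q, x u q := by simp
      rw [h2, h3]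
      have := hx1 u
      linarith
    by_cases hfm : val w f = val w m
    · refine ⟨f, hfi, hstep.trans ?_⟩
      have h0 := hu f hfi hfm
      have hne : f u ≠ u := fun e => by rw [e, hd] at h0; exact lt_irrefl _ h0
      have : val w' f + 2 ≤ val w f := by
        have e : ∑ v, (w' v (f v) + ((if v = u then 1 else 0) + (if v = f u then 1 else 0))) =
            val w' f + 2 := by
          simp [Finset.sum_add_distrib, val]
        rw [← e]
        refine Finset.sum_le_sum fun v _ => ?_
        by_cases h1 : v = u
        · subst h1; simp [w', hne.symm]; omega
        · by_cases h2 : v = f u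
          · subst h2
            rw [hs] at h0
            simp [w', h1, hfi]; omega
          · simp [w', h1, h2]
      have : (val w' f : ℝ) + 2 ≤ val w f := by exact_mod_cast this
      linarith
    · refine ⟨m, hmi, hstep.trans ?_⟩
      have h1 := hmax f ((hI f).2 hfi)
      have h2 := val_even hs hd hfi
      have h3 := val_even hs hd hmi
      have h4 : val w' f ≤ val w f := Finset.sum_le_sum fun v _ => hle _ _
      have : val w' f + 2 ≤ val w m := by omega
      have : (val w' f : ℝ) + 2 ≤ val w m := by exact_mod_cast this
      linarith
  · push Not at hcase
    have hmiss : ∀ t, ∃ N : V → V, (∀ v, N (N v) = v) ∧ Ok w N ∧ N t = t ∧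
        ∀ f : V → V, (∀ v, f (f v) = v) → val w f ≤ val w N := by
      intro t
      obtain ⟨f, hfi, hfm, hft⟩ := hcase t
      obtain ⟨g, hgi, hgo, hgv, hg⟩ := okify hs hd hfi
      refine ⟨g, hgi, hgo, hg t (by omega), fun h hh => ?_⟩
      rw [hgv, hfm]
      exact hmax h ((hI h).2 hh)
    obtain ⟨C, haC, hbC, f, hfi, hf⟩ := bump hs hd hmiss (Nat.pos_of_ne_zero hab)
    set w' : V → V → ℕ := fun u v => w u v - if u ∈ C ∧ v ∈ C then 1 else 0 with hw'
    have hs' : ∀ p q, w' p q = w' q p := by intro p q; simp only [w', hs p q, and_comm]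
    have hd' : ∀ v, w' v v = 0 := by intro v; simp [w', hd]
    have hle : ∀ p q, w' p q ≤ w p q := fun p q => Nat.sub_le _ _
    obtain ⟨g, hgi, hg⟩ := ih _ (hlt w' hle ⟨a, b, by simp [w', haC, hbC]; omega⟩) w' hs' hd' rfl
    refine ⟨f, hfi, ?_⟩
    have hfg : (val w' g : ℝ) + 2 * ((C.card / 2 : ℕ) : ℝ) ≤ val w f := by
      exact_mod_cast hf g hgi
    have hCx : ∑ u ∈ C, ∑ v ∈ C, x u v ≤ 2 * ((C.card / 2 : ℕ) : ℝ) := by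
      rcases Nat.even_or_odd C.card with h | h
      · have h1 : ∑ u ∈ C, ∑ v ∈ C, x u v ≤ ∑ u ∈ C, (1 : ℝ) := by
          refine Finset.sum_le_sum fun u _ => le_trans ?_ (hx1 u)
          exact Finset.sum_le_sum_of_subset_of_nonneg (Finset.subset_univ _) (fun v _ _ => hx0 u v)
        have h2 : 2 * (C.card / 2) = C.card := Nat.two_mul_div_two_of_even h
        have h3 : 2 * ((C.card / 2 : ℕ) : ℝ) = C.card := by exact_mod_cast h2
        rw [h3]
        simpa using h1
      · exact hxS C (C.card / 2) (Nat.two_mul_div_two_add_one_of_odd h).symm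
    have hstep : ∑ p, ∑ q, (w p q : ℝ) * x p q ≤ ∑ p, ∑ q, (w' p q : ℝ) * x p q +
        ∑ u ∈ C, ∑ v ∈ C, x u v := by
      have e : ∑ u ∈ C, ∑ v ∈ C, x u v = ∑ u, ∑ v, if u ∈ C ∧ v ∈ C then x u v else 0 := by
        simp only [ite_and]
        rw [← Finset.sum_filter_add_sum_filter_not Finset.univ (fun u => u ∈ C)]
        rw [Finset.sum_congr (g := fun _ => (0 : ℝ)) (s₁ := Finset.univ.filter (fun u => u ∉ C)) rfl]
        · simp only [Finset.sum_const_zero, add_zero]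
          refine Finset.sum_congr (by ext; simp) ?_
          intro u hu
          have hu' : u ∈ C := by simpa using hu
          simp [hu', Finset.sum_ite_mem]
        · intro u hu
          simp only [Finset.mem_filter] at hu
          simp [hu.2]
      rw [e, ← Finset.sum_add_distrib]
      refine Finset.sum_le_sum fun p _ => ?_
      rw [← Finset.sum_add_distrib]
      refine Finset.sum_le_sum fun q _ => ?_
      by_cases h : p ∈ C ∧ q ∈ C
      · have hc : (w p q : ℝ) ≤ w' p q + 1 := by
          have : w p q ≤ w' p q + 1 := by simp only [w', h, and_self, if_true]; omega
          exact_mod_cast this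
        have := mul_le_mul_of_nonneg_right hc (hx0 p q)
        rw [if_pos h]; linarith
      · simp [w', h]
    linarith

theorem sum_extend [Fintype V] (G : SimpleGraph V) [Fintype G.edgeSet] (F : G.edgeSet → ℝ) (v : V) :
    ∑ u, extendE G F s(v, u) = ∑ e : G.edgeSet, if v ∈ (e : Sym2 V) then F e else 0 := by
  have h1 : ∀ e : G.edgeSet, (if v ∈ (e : Sym2 V) then F e else 0) =
      ∑ u, if (e : Sym2 V) = s(v, u) then F e else 0 := by
    intro e
    by_cases h : v ∈ (e : Sym2 V)
    · obtain ⟨u0, hu0⟩ := Sym2.mem_iff_exists.1 h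
      rw [if_pos h, Finset.sum_eq_single u0]
      · rw [if_pos hu0]
      · intro u _ hu
        rw [if_neg]
        rw [hu0]
        intro e
        exact hu (Sym2.congr_right.1 e).symm
      · simp
    · rw [if_neg h, Finset.sum_eq_zero]
      intro u _
      rw [if_neg]
      intro e
      exact h (e ▸ Sym2.mem_mk_left v u)
  simp_rw [h1]
  rw [Finset.sum_comm]
  refine Finset.sum_congr rfl fun u _ => ?_
  unfold extendE
  by_cases h : s(v, u) ∈ G.edgeSet
  · rw [dif_pos h, Finset.sum_eq_single ⟨s(v, u), h⟩]
    · simp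
    · intro e _ he
      rw [if_neg]
      intro e'
      exact he (Subtype.ext e')
    · simp
  · rw [dif_neg h, Finset.sum_eq_zero]
    intro e _
    rw [if_neg]
    intro e'
    exact h (e' ▸ e.2)

theorem sum_inc [Fintype V] (G : SimpleGraph V) [Fintype G.edgeSet] (F : G.edgeSet → ℝ) :
    ∑ v, ∑ e : G.edgeSet, (if v ∈ (e : Sym2 V) then F e else 0) = 2 * ∑ e, F e := by
  rw [Finset.sum_comm, Finset.mul_sum]
  refine Finset.sum_congr rfl fun e _ => ?_
  obtain ⟨e, he⟩ := e
  induction e using Sym2.ind with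
  | _ a b =>
  have hab : a ≠ b := G.ne_of_adj (G.mem_edgeSet.1 he)
  rw [← Finset.sum_filter]
  have : (Finset.univ.filter (fun v => v ∈ s(a, b))) = {a, b} := by
    ext v; simp
  simp only [this]
  rw [Finset.sum_pair hab]
  ring

theorem sum_extend2 [Fintype V] (G : SimpleGraph V) [Fintype G.edgeSet] (F : G.edgeSet → ℝ) :
    ∑ v, ∑ u, extendE G F s(v, u) = 2 * ∑ e, F e := by
  simp_rw [sum_extend]
  exact sum_inc G F

/-- Every point of `P(G)` is dominated by a matching in every nonnegative integral direction. -/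
theorem dom [Fintype V] (G : SimpleGraph V) [Fintype G.edgeSet] {x : G.edgeSet → ℝ}
    (hx : x ∈ matchingPolyhedron G) (W : G.edgeSet → ℕ) :
    ∃ M, IsMatchingOf G M ∧ ∑ e, (W e : ℝ) * x e ≤ ∑ e, (W e : ℝ) * chi G M e := by
  obtain ⟨hx0, hx1, hxS⟩ := hx
  let w : V → V → ℕ := fun u v => if h : s(u, v) ∈ G.edgeSet then W ⟨s(u, v), h⟩ else 0
  have hws : ∀ u v, w u v = w v u := by
    intro u v
    have : s(u, v) = s(v, u) := Sym2.eq_swap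
    simp only [w, this]
  have hwd : ∀ v, w v v = 0 := by intro v; simp [w]
  obtain ⟨f, hfi, hf⟩ := core (fun u v => extendE G x s(u, v))
    (by intro u v; unfold extendE; split_ifs; exacts [hx0 _, le_rfl])
    (by intro u v; simp only [Sym2.eq_swap])
    (by intro v; rw [sum_extend]; exact hx1 v)
    (by
      intro S k hS
      have h := hxS S k hS
      have h2 := sum_extend2 G (fun e => if ∀ w ∈ (e : Sym2 V), w ∈ S then x e else 0)
      have h3 : ∑ u ∈ S, ∑ v ∈ S, extendE G x s(u, v) =
          ∑ v, ∑ u, extendE G (fun e => if ∀ w ∈ (e : Sym2 V), w ∈ S then x e else 0) s(v, u) := by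
        rw [← Finset.sum_subset (Finset.subset_univ S)]
        · refine Finset.sum_congr rfl fun u hu => ?_
          rw [← Finset.sum_subset (Finset.subset_univ S)]
          · refine Finset.sum_congr rfl fun v hv => ?_
            unfold extendE
            simp [hu, hv]
          · intro v _ hv
            unfold extendE
            simp [hv]
        · intro u _ hu
          unfold extendE
          simp [hu]
      rw [h3, h2]
      linarith) _ w hws hwd rfl
  let M : Set (Sym2 V) := {e | e ∈ G.edgeSet ∧ ∃ v, e = s(v, f v)}
  have hM : IsMatchingOf G M := by
    refine ⟨fun e he => he.1, ?_⟩
    have key : ∀ e ∈ M, ∀ v ∈ e, e = s(v, f v) := by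
      rintro e ⟨-, z, rfl⟩ v hv
      rcases Sym2.mem_iff.1 hv with rfl | rfl
      · rfl
      · rw [hfi]; exact Sym2.eq_swap
    intro e he e' he' hne v hv
    exact hne ((key e he v hv.1).trans (key e' he' v hv.2).symm)
  refine ⟨M, hM, ?_⟩
  have h1 : ∑ u, ∑ v, (w u v : ℝ) * extendE G x s(u, v) = 2 * ∑ e, (W e : ℝ) * x e := by
    rw [← sum_extend2]
    refine Finset.sum_congr rfl fun u _ => Finset.sum_congr rfl fun v _ => ?_
    simp only [w, extendE]
    split_ifs <;> simp
  have h2 : (val w f : ℝ) ≤ 2 * ∑ e, (W e : ℝ) * chi G M e := by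
    rw [← sum_inc, val]
    push_cast
    refine Finset.sum_le_sum fun v _ => ?_
    have hnn : ∀ e ∈ (Finset.univ : Finset G.edgeSet),
        0 ≤ (if v ∈ (e : Sym2 V) then (W e : ℝ) * chi G M e else 0) := by
      intro e _
      unfold chi
      split_ifs <;> simp
    by_cases h : s(v, f v) ∈ G.edgeSet
    · have := Finset.single_le_sum hnn (Finset.mem_univ ⟨s(v, f v), h⟩)
      refine le_trans (le_of_eq ?_) this
      have hm : s(v, f v) ∈ M := ⟨h, v, rfl⟩
      simp only [w, dif_pos h, chi, if_pos hm]
      simp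
    · simp only [w, dif_neg h]
      simpa using Finset.sum_nonneg hnn
  linarith

theorem chi_mem [Fintype V] (G : SimpleGraph V) [Fintype G.edgeSet] {M : Set (Sym2 V)}
    (hM : IsMatchingOf G M) : chi G M ∈ matchingPolyhedron G := by
  have hdeg : ∀ v : V, (∑ e : G.edgeSet, if v ∈ (e : Sym2 V) then chi G M e else 0) ≤ 1 := by
    intro v
    by_cases h : ∃ e0 : G.edgeSet, v ∈ (e0 : Sym2 V) ∧ (e0 : Sym2 V) ∈ M
    · obtain ⟨e0, h1, h2⟩ := h
      rw [Finset.sum_eq_single e0]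
      · simp [chi, h1, h2]
      · intro e _ he
        by_cases hv : v ∈ (e : Sym2 V)
        · have : (e : Sym2 V) ∉ M := fun hm =>
            hM.2 e hm e0 h2 (fun h => he (Subtype.ext h)) v ⟨hv, h1⟩
          simp [chi, this]
        · simp [hv]
      · simp
    · push Not at h
      rw [Finset.sum_eq_zero]
      · exact zero_le_one
      · intro e _
        by_cases hv : v ∈ (e : Sym2 V)
        · simp [chi, h e hv]
        · simp [hv]
  have h0 : ∀ e, 0 ≤ chi G M e := by intro e; unfold chi; split_ifs <;> simp
  refine ⟨h0, hdeg, ?_⟩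
  intro S k hS
  have h1 := sum_inc G (fun e => if ∀ w ∈ (e : Sym2 V), w ∈ S then chi G M e else 0)
  have h2 : ∑ v, ∑ e : G.edgeSet, (if v ∈ (e : Sym2 V) then
      (if ∀ w ∈ (e : Sym2 V), w ∈ S then chi G M e else 0) else 0) ≤ ∑ v ∈ S, (1 : ℝ) := by
    rw [← Finset.sum_subset (Finset.subset_univ S)]
    · refine Finset.sum_le_sum fun v _ => le_trans (Finset.sum_le_sum fun e _ => ?_) (hdeg v)
      split_ifs <;> first | exact le_rfl | exact h0 e
    · intro v _ hv
      refine Finset.sum_eq_zero fun e _ => ?_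
      by_cases hve : v ∈ (e : Sym2 V)
      · rw [if_pos hve, if_neg]
        intro h
        exact hv (h v hve)
      · rw [if_neg hve]
  rw [h1] at h2
  have h3 : ∃ n : ℕ, (∑ e : G.edgeSet, if ∀ w ∈ (e : Sym2 V), w ∈ S then chi G M e else 0) = n := by
    refine ⟨∑ e : G.edgeSet, if ∀ w ∈ (e : Sym2 V), w ∈ S then (if (e : Sym2 V) ∈ M then 1 else 0) else 0, ?_⟩
    push_cast
    rfl
  obtain ⟨n, hn⟩ := h3
  rw [hn] at h2 ⊢
  simp only [Finset.sum_const, hS, nsmul_eq_mul, mul_one] at h2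
  have h2' : 2 * n ≤ 2 * k + 1 := by exact_mod_cast h2
  have : n ≤ k := by omega
  exact_mod_cast this

theorem coord_le_one [Fintype V] (G : SimpleGraph V) [Fintype G.edgeSet] {x : G.edgeSet → ℝ}
    (hx : x ∈ matchingPolyhedron G) (e : G.edgeSet) : x e ≤ 1 := by
  obtain ⟨h0, h1, -⟩ := hx
  obtain ⟨v, hv⟩ : ∃ v, v ∈ (e : Sym2 V) := ⟨_, Sym2.out_fst_mem _⟩
  have := Finset.single_le_sum (f := fun e : G.edgeSet => if v ∈ (e : Sym2 V) then x e else 0)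
    (fun e _ => by split_ifs; exacts [h0 e, le_rfl]) (Finset.mem_univ e)
  simp only [hv, if_true] at this
  exact this.trans (h1 v)

theorem subset_hull [Fintype V] (G : SimpleGraph V) [Fintype G.edgeSet] :
    matchingPolyhedron G ⊆
      convexHull ℝ {x : G.edgeSet → ℝ | ∃ M : Set (Sym2 V), IsMatchingOf G M ∧ x = chi G M} := by
  intro x hx
  by_contra hxn
  set T := {x : G.edgeSet → ℝ | ∃ M : Set (Sym2 V), IsMatchingOf G M ∧ x = chi G M} with hT
  have hfin : T.Finite := by
    refine (Set.finite_range (fun M : Set (Sym2 V) => chi G M)).subset ?_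
    rintro y ⟨M, -, rfl⟩
    exact ⟨M, rfl⟩
  obtain ⟨φ, u, h1, h2⟩ := geometric_hahn_banach_closed_point (convex_convexHull ℝ T)
    (hfin.isClosed_convexHull ℝ) hxn
  let c : G.edgeSet → ℝ := fun e => φ (Pi.single e 1)
  have hφ : ∀ y : G.edgeSet → ℝ, φ y = ∑ e, c e * y e := by
    intro y
    conv_lhs => rw [← Finset.univ_sum_single y]
    rw [map_sum]
    refine Finset.sum_congr rfl fun e _ => ?_
    have : (Pi.single e (y e) : G.edgeSet → ℝ) = y e • Pi.single e 1 := by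
      rw [← Pi.single_smul]; simp
    rw [this, map_smul, smul_eq_mul, mul_comm]
  have hx0 := hx.1
  obtain ⟨n, hn⟩ := exists_nat_gt ((Fintype.card G.edgeSet : ℝ) / (φ x - u))
  rw [div_lt_iff₀ (by linarith)] at hn
  obtain ⟨M, hM, hle⟩ := dom G hx (fun e => ⌈(n : ℝ) * max (c e) 0⌉₊)
  let M' : Set (Sym2 V) := {e | e ∈ M ∧ ∃ h : e ∈ G.edgeSet, 0 < c ⟨e, h⟩}
  have hM' : IsMatchingOf G M' :=
    ⟨fun e he => hM.1 he.1, fun e he f hf => hM.2 e he.1 f hf.1⟩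
  have h3 := h1 (chi G M') (subset_convexHull ℝ T ⟨M', hM', rfl⟩)
  have h4 : (n : ℝ) * φ x ≤ ∑ e, ((⌈(n : ℝ) * max (c e) 0⌉₊ : ℕ) : ℝ) * x e := by
    rw [hφ, Finset.mul_sum]
    refine Finset.sum_le_sum fun e _ => ?_
    rw [← mul_assoc]
    refine mul_le_mul_of_nonneg_right (le_trans ?_ (Nat.le_ceil _)) (hx0 e)
    exact mul_le_mul_of_nonneg_left (le_max_left _ _) (Nat.cast_nonneg n)
  have h5 : ∑ e, ((⌈(n : ℝ) * max (c e) 0⌉₊ : ℕ) : ℝ) * chi G M e ≤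
      (n : ℝ) * φ (chi G M') + Fintype.card G.edgeSet := by
    have : (Fintype.card G.edgeSet : ℝ) = ∑ e : G.edgeSet, (1 : ℝ) := by simp
    rw [hφ, Finset.mul_sum, this, ← Finset.sum_add_distrib]
    refine Finset.sum_le_sum fun e _ => ?_
    by_cases hm : (e : Sym2 V) ∈ M
    · by_cases hc : 0 < c e
      · have hm' : (e : Sym2 V) ∈ M' := ⟨hm, e.2, hc⟩
        have := (Nat.ceil_lt_add_one (a := (n : ℝ) * max (c e) 0) (by positivity)).le
        rw [max_eq_left hc.le] at this ⊢
        simpa [chi, hm, hm'] using this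
      · have hm' : (e : Sym2 V) ∉ M' := fun h => hc h.2.2
        rw [max_eq_right (not_lt.1 hc)]
        simp [chi, hm']
    · have hm' : (e : Sym2 V) ∉ M' := fun h => hm h.1
      simp [chi, hm, hm']
  have h6 : (n : ℝ) * φ (chi G M') ≤ n * u := mul_le_mul_of_nonneg_left h3.le (Nat.cast_nonneg n)
  have h7 : (n : ℝ) * (φ x - u) ≤ Fintype.card G.edgeSet := by
    rw [mul_sub]; linarith
  linarith

theorem convex_mp [Fintype V] (G : SimpleGraph V) [Fintype G.edgeSet] :
    Convex ℝ (matchingPolyhedron G) := by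
  have hlin : ∀ (p : G.edgeSet → Prop) [DecidablePred p] (x y : G.edgeSet → ℝ) (a b : ℝ),
      (∑ e, if p e then (a • x + b • y) e else 0) =
        a * (∑ e, if p e then x e else 0) + b * (∑ e, if p e then y e else 0) := by
    intro p _ x y a b
    rw [Finset.mul_sum, Finset.mul_sum, ← Finset.sum_add_distrib]
    refine Finset.sum_congr rfl fun e _ => ?_
    split_ifs <;> simp
  have hcomb : ∀ (a b s t r : ℝ), 0 ≤ a → 0 ≤ b → a + b = 1 → s ≤ r → t ≤ r →
      a * s + b * t ≤ r := by
    intro a b s t r ha hb hab hs ht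
    calc a * s + b * t ≤ a * r + b * r := by gcongr
      _ = r := by rw [← add_mul, hab, one_mul]
  rintro x ⟨hx0, hx1, hxS⟩ y ⟨hy0, hy1, hyS⟩ a b ha hb hab
  refine ⟨fun e => ?_, fun v => ?_, fun S k hS => ?_⟩
  · have := hx0 e
    have := hy0 e
    simp only [Pi.add_apply, Pi.smul_apply, smul_eq_mul]
    positivity
  · rw [hlin (fun e => v ∈ (e : Sym2 V))]; exact hcomb _ _ _ _ _ ha hb hab (hx1 v) (hy1 v)
  · rw [hlin (fun e => ∀ w ∈ (e : Sym2 V), w ∈ S)]; exact hcomb _ _ _ _ _ ha hb hab (hxS S k hS) (hyS S k hS)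

theorem main [Fintype V] (G : SimpleGraph V) [Fintype G.edgeSet] :
    Set.extremePoints ℝ (matchingPolyhedron G) =
      {x : G.edgeSet → ℝ | ∃ M : Set (Sym2 V), IsMatchingOf G M ∧ x = chi G M} := by
  apply Set.Subset.antisymm
  · have h : matchingPolyhedron G =
        convexHull ℝ {x : G.edgeSet → ℝ | ∃ M : Set (Sym2 V), IsMatchingOf G M ∧ x = chi G M} := by
      apply Set.Subset.antisymm (subset_hull G)
      apply convexHull_min _ (convex_mp G)
      rintro x ⟨M, hM, rfl⟩
      exact chi_mem G hM
    rw [h]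
    exact extremePoints_convexHull_subset
  · rintro x ⟨M, hM, rfl⟩
    rw [mem_extremePoints_iff_left]
    refine ⟨chi_mem G hM, ?_⟩
    rintro y hy z hz ⟨a, b, ha, hb, hab, he⟩
    funext e
    have h1 := congrFun he e
    simp only [Pi.add_apply, Pi.smul_apply, smul_eq_mul] at h1
    have y0 := hy.1 e
    have z0 := hz.1 e
    have y1 := coord_le_one G hy e
    have z1 := coord_le_one G hz e
    unfold chi at h1 ⊢
    split_ifs at h1 ⊢
    · nlinarith
    · nlinarith

end EdmondsMP

/-- The extreme points of the matching polyhedron are exactly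
the indicator vectors of matchings of `G`. -/
theorem extremePoints_matchingPolyhedron [Fintype V] [DecidableEq V]
    (G : SimpleGraph V) [DecidableRel G.Adj] :
    Set.extremePoints ℝ (matchingPolyhedron G) =
      {x : G.edgeSet → ℝ | ∃ M : Set (Sym2 V), IsMatchingOf G M ∧ x = chi G M} :=
  EdmondsMP.main G
end
end

section
/- Let G be a finite simple graph with edge set E, and let M1 ≠ M2 be matchings of G. The vertices χ_{M1} and χ_{M2} of the matching polyhedron P(G) are adjacent — that is, the closed segment [χ_{M1}, χ_{M2}] is an exposed face of P(G) — if and only if the symmetric difference M1 Δ M2 is the edge set of a simple path in G or of a simple cycle of even length in G. -/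
open scoped symmDiff
open Classical

noncomputable section

variable {V : Type*}

/-- Total weight of the edges at `v`. -/
def vload (G : SimpleGraph V) [Fintype G.edgeSet] (x : G.edgeSet → ℝ) (v : V) : ℝ :=
  ∑ e : G.edgeSet, if v ∈ (e : Sym2 V) then x e else 0

lemma chi_nonneg (G : SimpleGraph V) (M : Set (Sym2 V)) (e) : 0 ≤ chi G M e := by
  unfold chi; split_ifs <;> norm_num

lemma vload_covered (G : SimpleGraph V) [Fintype G.edgeSet] {M : Set (Sym2 V)}
    (h : IsMatchingOf G M) {v : V} {e : Sym2 V} (he : e ∈ M) (hv : v ∈ e) :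
    vload G (chi G M) v = 1 := by
  unfold vload
  rw [Finset.sum_eq_single (⟨e, h.1 he⟩ : G.edgeSet)]
  · simp [hv, chi, he]
  · intro f _ hf
    by_cases hvf : v ∈ (f : Sym2 V)
    · have : (f : Sym2 V) ∉ M := fun hfM =>
        h.2 f hfM e he (fun h' => hf (Subtype.ext h')) v ⟨hvf, hv⟩
      simp [chi, this]
    · simp [hvf]
  · simp

lemma vload_uncovered (G : SimpleGraph V) [Fintype G.edgeSet] {M : Set (Sym2 V)}
    {v : V} (hv : ∀ e ∈ M, v ∉ e) :
    vload G (chi G M) v = 0 := by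
  unfold vload
  refine Finset.sum_eq_zero fun f _ => ?_
  by_cases hvf : v ∈ (f : Sym2 V)
  · have : (f : Sym2 V) ∉ M := fun hfM => hv f hfM hvf
    simp [chi, this]
  · simp [hvf]

lemma vload_le (G : SimpleGraph V) [Fintype G.edgeSet] {M : Set (Sym2 V)}
    (h : IsMatchingOf G M) (v : V) : vload G (chi G M) v ≤ 1 := by
  by_cases hc : ∃ e ∈ M, v ∈ e
  · obtain ⟨e, he, hv⟩ := hc
    exact (vload_covered G h he hv).le
  · push Not at hc
    rw [vload_uncovered G hc]; norm_num

lemma chi_mem (G : SimpleGraph V) [Fintype V] [Fintype G.edgeSet] {M : Set (Sym2 V)}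
    (h : IsMatchingOf G M) : chi G M ∈ matchingPolyhedron G := by
  refine ⟨chi_nonneg G M, vload_le G h, fun S k hS => ?_⟩
  have key : 2 * (∑ e : G.edgeSet, if ∀ w ∈ (e : Sym2 V), w ∈ S then chi G M e else 0)
      ≤ ∑ v ∈ S, vload G (chi G M) v := by
    unfold vload
    rw [Finset.sum_comm, Finset.mul_sum]
    refine Finset.sum_le_sum fun e _ => ?_
    have hn := chi_nonneg G M e
    split_ifs with hw
    · obtain ⟨e, he⟩ := e
      induction e using Sym2.ind with
      | _ a b =>
        have hab : a ≠ b := G.ne_of_adj he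
        have ha : a ∈ S := hw a (by simp)
        have hb : b ∈ S := hw b (by simp)
        calc _ = ∑ v ∈ ({a, b} : Finset V), (if v ∈ s(a, b) then chi G M ⟨s(a, b), he⟩ else 0) := by
              rw [Finset.sum_pair hab]; simp; ring
          _ ≤ _ := by
              apply Finset.sum_le_sum_of_subset_of_nonneg
              · intro v hv
                simp only [Finset.mem_insert, Finset.mem_singleton] at hv
                rcases hv with rfl | rfl <;> assumption
              · intro i _ _
                split_ifs <;> first | exact hn | exact le_rfl
    · rw [mul_zero]
      refine Finset.sum_nonneg fun i _ => ?_
      split_ifs <;> first | exact hn | exact le_rfl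
  have h2 : ∑ v ∈ S, vload G (chi G M) v ≤ S.card := by
    calc _ ≤ ∑ v ∈ S, (1 : ℝ) := Finset.sum_le_sum fun v _ => vload_le G h v
      _ = _ := by simp
  have h3 : (∑ e : G.edgeSet, if ∀ w ∈ (e : Sym2 V), w ∈ S then chi G M e else 0)
      = ((Finset.univ.filter fun e : G.edgeSet =>
          (∀ w ∈ (e : Sym2 V), w ∈ S) ∧ (e : Sym2 V) ∈ M).card : ℝ) := by
    rw [Finset.card_filter, Nat.cast_sum]
    refine Finset.sum_congr rfl fun e _ => ?_
    unfold chi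
    by_cases h1 : ∀ w ∈ (e : Sym2 V), w ∈ S <;> by_cases h2 : (e : Sym2 V) ∈ M <;> simp [h1, h2]
  rw [h3] at key ⊢
  have h4 := key.trans h2
  rw [hS] at h4
  have h5 := (by exact_mod_cast h4 :
    2 * (Finset.univ.filter fun e : G.edgeSet =>
          (∀ w ∈ (e : Sym2 V), w ∈ S) ∧ (e : Sym2 V) ∈ M).card ≤ 2 * k + 1)
  have h6 : (Finset.univ.filter fun e : G.edgeSet =>
          (∀ w ∈ (e : Sym2 V), w ∈ S) ∧ (e : Sym2 V) ∈ M).card ≤ k := by omega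
  exact_mod_cast h6

/-- A function on edges which agrees on incident edges is constant along a walk. -/
lemma walk_const (G : SimpleGraph V) (y : Sym2 V → ℝ) {u v : V} (p : G.Walk u v)
    (hy : ∀ e ∈ p.edges, ∀ f ∈ p.edges, ∀ w, w ∈ e → w ∈ f → y e = y f) :
    ∀ e ∈ p.edges, ∀ f ∈ p.edges, y e = y f := by
  induction p with
  | nil => simp
  | @cons u u' v h q ih =>
    have ih' := ih (fun e he f hf => hy e (by simp [he]) f (by simp [hf]))
    have hfirst : ∀ f ∈ q.edges, y s(u, u') = y f := by
      intro f hf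
      cases q with
      | nil => simp at hf
      | @cons _ u'' _ h' q' =>
        rw [← ih' s(u', u'') (by simp) f hf]
        exact hy _ (by simp) _ (by simp) u' (by simp) (by simp)
    intro e he f hf
    rw [SimpleGraph.Walk.edges_cons, List.mem_cons] at he hf
    rcases he with rfl | he <;> rcases hf with rfl | hf
    · rfl
    · exact hfirst f hf
    · exact (hfirst e he).symm
    · exact ih' e he f hf

lemma exposed_of_path (G : SimpleGraph V) [Fintype V] [Fintype G.edgeSet] (M1 M2 : Set (Sym2 V))
    (h1 : IsMatchingOf G M1) (h2 : IsMatchingOf G M2) (hne : M1 ≠ M2)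
    (h : IsPathOrEvenCycleEdgeSet G (M1 ∆ M2)) :
    IsExposed ℝ (matchingPolyhedron G) (segment ℝ (chi G M1) (chi G M2)) := by
  intro _
  obtain ⟨u, v, p, -, hp⟩ := h
  set C : Finset V := Finset.univ.filter
    fun v => (∃ e ∈ M1, v ∈ e) ∧ (∃ e ∈ M2, v ∈ e) with hC
  set l : StrongDual ℝ (G.edgeSet → ℝ) :=
    (∑ v ∈ C, ∑ e : G.edgeSet, if v ∈ (e : Sym2 V) then
      (ContinuousLinearMap.proj e : StrongDual ℝ (G.edgeSet → ℝ)) else 0) -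
    ∑ e : G.edgeSet, if (e : Sym2 V) ∈ M1 ∪ M2 then 0 else
      (ContinuousLinearMap.proj e : StrongDual ℝ (G.edgeSet → ℝ)) with hl
  have hlx : ∀ x, l x = ∑ v ∈ C, vload G x v -
      ∑ e : G.edgeSet, if (e : Sym2 V) ∈ M1 ∪ M2 then 0 else x e := by
    intro x
    rw [hl, _root_.sub_apply, _root_.sum_apply,
      _root_.sum_apply]
    congr 1
    · refine Finset.sum_congr rfl fun v _ => ?_
      rw [_root_.sum_apply]
      refine Finset.sum_congr rfl fun e _ => ?_
      split_ifs <;> simp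
    · refine Finset.sum_congr rfl fun e _ => ?_
      split_ifs <;> simp
  have hle : ∀ x ∈ matchingPolyhedron G, l x ≤ C.card := by
    intro x hx
    rw [hlx]
    have a1 : ∑ v ∈ C, vload G x v ≤ ∑ v ∈ C, (1 : ℝ) :=
      Finset.sum_le_sum fun v _ => hx.2.1 v
    have a2 : 0 ≤ ∑ e : G.edgeSet, if (e : Sym2 V) ∈ M1 ∪ M2 then 0 else x e :=
      Finset.sum_nonneg fun e _ => by
        split_ifs
        · exact le_rfl
        · exact hx.1 e
    simp at a1
    linarith
  have hchi : ∀ M, IsMatchingOf G M → (M ⊆ M1 ∪ M2) → (∀ v ∈ C, ∃ e ∈ M, v ∈ e) →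
      l (chi G M) = C.card := by
    intro M hM hsub hcov
    rw [hlx]
    have a1 : ∑ v ∈ C, vload G (chi G M) v = ∑ v ∈ C, (1 : ℝ) :=
      Finset.sum_congr rfl fun v hv => by
        obtain ⟨e, he, hve⟩ := hcov v hv
        exact vload_covered G hM he hve
    have a2 : (∑ e : G.edgeSet, if (e : Sym2 V) ∈ M1 ∪ M2 then 0 else chi G M e) = 0 :=
      Finset.sum_eq_zero fun e _ => by
        split_ifs with hh
        · rfl
        · have : (e : Sym2 V) ∉ M := fun h => hh (hsub h)
          simp [chi, this]
    rw [a1, a2]; simp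
  have hc1 : l (chi G M1) = C.card := hchi M1 h1 Set.subset_union_left
    (fun v hv => by rw [hC, Finset.mem_filter] at hv; exact hv.2.1)
  have hc2 : l (chi G M2) = C.card := hchi M2 h2 Set.subset_union_right
    (fun v hv => by rw [hC, Finset.mem_filter] at hv; exact hv.2.2)
  have hconv : Convex ℝ (matchingPolyhedron G) := by
    intro x hx y hy a b ha hb hab
    refine ⟨fun e => ?_, fun v => ?_, fun S k hS => ?_⟩
    · have := hx.1 e
      have := hy.1 e
      simp only [Pi.add_apply, Pi.smul_apply, smul_eq_mul]
      positivity
    · have e1 := hx.2.1 v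
      have e2 := hy.2.1 v
      have : (∑ e : G.edgeSet, if v ∈ (e : Sym2 V) then (a • x + b • y) e else 0) =
          a * (∑ e : G.edgeSet, if v ∈ (e : Sym2 V) then x e else 0) +
          b * (∑ e : G.edgeSet, if v ∈ (e : Sym2 V) then y e else 0) := by
        rw [Finset.mul_sum, Finset.mul_sum, ← Finset.sum_add_distrib]
        refine Finset.sum_congr rfl fun e _ => ?_
        split_ifs <;> simp
      rw [this]
      nlinarith
    · have e1 := hx.2.2 S k hS
      have e2 := hy.2.2 S k hS
      have : (∑ e : G.edgeSet, if ∀ w ∈ (e : Sym2 V), w ∈ S then (a • x + b • y) e else 0) =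
          a * (∑ e : G.edgeSet, if ∀ w ∈ (e : Sym2 V), w ∈ S then x e else 0) +
          b * (∑ e : G.edgeSet, if ∀ w ∈ (e : Sym2 V), w ∈ S then y e else 0) := by
        rw [Finset.mul_sum, Finset.mul_sum, ← Finset.sum_add_distrib]
        refine Finset.sum_congr rfl fun e _ => ?_
        split_ifs <;> simp
      rw [this]
      calc _ ≤ a * (k : ℝ) + b * k := by gcongr
        _ = k := by rw [← add_mul, hab, one_mul]
  refine ⟨l, Set.Subset.antisymm ?_ ?_⟩
  · intro x hx
    have hxP := hconv.segment_subset (chi_mem G h1) (chi_mem G h2) hx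
    refine ⟨hxP, fun y hy => ?_⟩
    obtain ⟨a, b, ha, hb, hab, rfl⟩ := hx
    rw [map_add, map_smul, map_smul, hc1, hc2]
    have := hle y hy
    simp only [smul_eq_mul]
    rw [← add_mul, hab, one_mul]
    exact this
  · rintro x ⟨hxP, hmax⟩
    have hlx1 : l x = C.card := le_antisymm (hle x hxP) (hc1 ▸ hmax _ (chi_mem G h1))
    have t0 : 0 ≤ ∑ e : G.edgeSet, if (e : Sym2 V) ∈ M1 ∪ M2 then 0 else x e :=
      Finset.sum_nonneg fun e _ => by
        split_ifs
        · exact le_rfl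
        · exact hxP.1 e
    have t1 : ∑ v ∈ C, vload G x v ≤ ∑ v ∈ C, (1 : ℝ) :=
      Finset.sum_le_sum fun v _ => hxP.2.1 v
    have t2 : ∑ v ∈ C, (1 : ℝ) = C.card := by simp
    rw [hlx] at hlx1
    have hload : ∀ v ∈ C, vload G x v = 1 :=
      (Finset.sum_eq_sum_iff_of_le fun v _ => hxP.2.1 v).1 (by
        change ∑ v ∈ C, vload G x v = _
        linarith)
    have hsupp : ∀ e : G.edgeSet, (e : Sym2 V) ∉ M1 ∪ M2 → x e = 0 := by
      have : (∑ e : G.edgeSet, if (e : Sym2 V) ∈ M1 ∪ M2 then 0 else x e) = 0 := by linarith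
      rw [Finset.sum_eq_zero_iff_of_nonneg (fun e _ => by
        split_ifs
        · exact le_rfl
        · exact hxP.1 e)] at this
      intro e he
      have := this e (Finset.mem_univ e)
      rwa [if_neg he] at this
    have hx1 : ∀ e : G.edgeSet, x e ≤ 1 := by
      intro e
      obtain ⟨w, hw⟩ : ∃ w, w ∈ (e : Sym2 V) := ⟨_, Sym2.out_fst_mem _⟩
      refine le_trans ?_ (hxP.2.1 w)
      calc x e = if w ∈ (e : Sym2 V) then x e else 0 := by rw [if_pos hw]
        _ ≤ _ := Finset.single_le_sum (f := fun e : G.edgeSet =>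
            if w ∈ (e : Sym2 V) then x e else 0) (fun i _ => by
            split_ifs
            · exact hxP.1 i
            · exact le_rfl) (Finset.mem_univ e)
    have hcom : ∀ e : G.edgeSet, (e : Sym2 V) ∈ M1 → (e : Sym2 V) ∈ M2 → x e = 1 := by
      intro e e1 e2
      obtain ⟨w, hw⟩ : ∃ w, w ∈ (e : Sym2 V) := ⟨_, Sym2.out_fst_mem _⟩
      have hwC : w ∈ C := by
        rw [hC, Finset.mem_filter]; exact ⟨Finset.mem_univ _, ⟨e, e1, hw⟩, ⟨e, e2, hw⟩⟩
      rw [← hload w hwC, vload, Finset.sum_eq_single e, if_pos hw]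
      · intro f _ hf
        split_ifs with hwf
        · apply hsupp
          rintro (hf1 | hf2)
          · exact h1.2 f hf1 e e1 (fun h => hf (Subtype.ext h)) w ⟨hwf, hw⟩
          · exact h2.2 f hf2 e e2 (fun h => hf (Subtype.ext h)) w ⟨hwf, hw⟩
        · rfl
      · simp
    have hadj : ∀ e f : G.edgeSet, (e : Sym2 V) ∈ M1 → (f : Sym2 V) ∈ M2 → e ≠ f →
        ∀ w, w ∈ (e : Sym2 V) → w ∈ (f : Sym2 V) → x e + x f = 1 := by
      intro e f e1 f2 hef w hwe hwf
      have hwC : w ∈ C := by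
        rw [hC, Finset.mem_filter]; exact ⟨Finset.mem_univ _, ⟨e, e1, hwe⟩, ⟨f, f2, hwf⟩⟩
      rw [← hload w hwC, vload, Finset.sum_eq_add e f hef, if_pos hwe, if_pos hwf]
      · rintro g _ ⟨hg1, hg2⟩
        split_ifs with hwg
        · apply hsupp
          rintro (hf1 | hf2)
          · exact h1.2 g hf1 e e1 (fun h => hg1 (Subtype.ext h)) w ⟨hwg, hwe⟩
          · exact h2.2 g hf2 f f2 (fun h => hg2 (Subtype.ext h)) w ⟨hwg, hwf⟩
        · rfl
      · simp
      · simp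
    -- the normalised value
    set y : Sym2 V → ℝ := fun e => if h : e ∈ G.edgeSet then
      (if e ∈ M1 then x ⟨e, h⟩ else 1 - x ⟨e, h⟩) else 0 with hy
    have hD : ∀ e, e ∈ p.edges ↔ e ∈ M1 ∆ M2 := fun e => by rw [hp]; rfl
    have hyc := walk_const G y p (by
      intro e he f hf w hwe hwf
      by_cases hef : e = f
      · rw [hef]
      have heG := p.edges_subset_edgeSet he
      have hfG := p.edges_subset_edgeSet hf
      rw [hD, Set.mem_symmDiff] at he hf
      simp only [hy, dif_pos heG, dif_pos hfG]
      rcases he with ⟨e1, e2⟩ | ⟨e2, e1⟩ <;> rcases hf with ⟨f1, f2⟩ | ⟨f2, f1⟩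
      · exact absurd ⟨hwe, hwf⟩ (h1.2 e e1 f f1 hef w)
      · have := hadj ⟨e, heG⟩ ⟨f, hfG⟩ e1 f2 (fun h => hef (congrArg Subtype.val h)) w hwe hwf
        rw [if_pos e1, if_neg f1]; linarith
      · have := hadj ⟨f, hfG⟩ ⟨e, heG⟩ f1 e2
          (fun h => hef (congrArg Subtype.val h).symm) w hwf hwe
        rw [if_neg e1, if_pos f1]; linarith
      · exact absurd ⟨hwe, hwf⟩ (h2.2 e e2 f f2 hef w))
    obtain ⟨e0, he0⟩ : (M1 ∆ M2).Nonempty := by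
      rw [Set.nonempty_iff_ne_empty]
      exact fun h => hne (symmDiff_eq_bot.1 h)
    have he0p := (hD e0).2 he0
    have he0G := p.edges_subset_edgeSet he0p
    have hb : 0 ≤ y e0 ∧ y e0 ≤ 1 := by
      have b1 := hxP.1 ⟨e0, he0G⟩
      have b2 := hx1 ⟨e0, he0G⟩
      simp only [hy, dif_pos he0G]
      split_ifs
      · exact ⟨b1, b2⟩
      · constructor <;> linarith
    refine ⟨y e0, 1 - y e0, hb.1, by linarith [hb.2], by ring, ?_⟩
    funext e
    simp only [Pi.add_apply, Pi.smul_apply, smul_eq_mul, chi]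
    by_cases e1 : (e : Sym2 V) ∈ M1 <;> by_cases e2 : (e : Sym2 V) ∈ M2
    · rw [if_pos e1, if_pos e2, hcom e e1 e2]; ring
    · have := hyc e0 he0p e ((hD _).2 (Or.inl ⟨e1, e2⟩))
      rw [if_pos e1, if_neg e2, this]
      simp [hy, e1]
    · have := hyc e0 he0p e ((hD _).2 (Or.inr ⟨e2, e1⟩))
      rw [if_neg e1, if_pos e2, this]
      simp [hy, e1]
    · rw [if_neg e1, if_neg e2, hsupp e (by rintro (h | h) <;> contradiction)]; ring

lemma swap_matching (G : SimpleGraph V) {M1 M2 A : Set (Sym2 V)}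
    (h1 : IsMatchingOf G M1) (h2 : IsMatchingOf G M2) (hA : A ⊆ M1 ∆ M2)
    (hcl : ∀ e ∈ A, ∀ f ∈ M1 ∆ M2, ∀ w, w ∈ e → w ∈ f → f ∈ A) :
    IsMatchingOf G (M1 ∆ A) := by
  have hA2 : ∀ e ∈ A, e ∉ M1 → e ∈ M2 := fun e he hn => by
    rcases hA he with h | h
    · exact absurd h.1 hn
    · exact h.1
  have key : ∀ e f w, e ∈ M1 → e ∉ A → f ∈ A → f ∉ M1 → w ∈ e → w ∈ f → False := by
    intro e f w e1 eA fA f1 hwe hwf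
    by_cases e2 : e ∈ M2
    · exact h2.2 e e2 f (hA2 f fA f1) (fun h => eA (h ▸ fA)) w ⟨hwe, hwf⟩
    · exact eA (hcl f fA e (Or.inl ⟨e1, e2⟩) w hwf hwe)
  constructor
  · rintro e (h | h)
    · exact h1.1 h.1
    · exact h2.1 (hA2 e h.1 h.2)
  · rintro e (he | he) f (hf | hf) hef w ⟨hwe, hwf⟩
    · exact h1.2 e he.1 f hf.1 hef w ⟨hwe, hwf⟩
    · exact key e f w he.1 he.2 hf.1 hf.2 hwe hwf
    · exact key f e w hf.1 hf.2 he.1 he.2 hwf hwe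
    · exact h2.2 e (hA2 e he.1 he.2) f (hA2 f hf.1 hf.2) hef w ⟨hwe, hwf⟩

/-- If the segment is exposed then any nonempty closed part of the symmetric difference is
everything. -/
lemma closed_part_eq (G : SimpleGraph V) [Fintype V] [Fintype G.edgeSet] {M1 M2 A : Set (Sym2 V)}
    (h1 : IsMatchingOf G M1) (h2 : IsMatchingOf G M2)
    (hexp : IsExposed ℝ (matchingPolyhedron G) (segment ℝ (chi G M1) (chi G M2)))
    (hA : A ⊆ M1 ∆ M2) (hAne : A.Nonempty)
    (hcl : ∀ e ∈ A, ∀ f ∈ M1 ∆ M2, ∀ w, w ∈ e → w ∈ f → f ∈ A) :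
    M1 ∆ M2 = A := by
  refine Set.Subset.antisymm (fun f hf => ?_) hA
  by_contra hfA
  have h3 := swap_matching G h1 h2 hA hcl
  have h4 : IsMatchingOf G (M2 ∆ A) := swap_matching G h2 h1 (by rwa [symmDiff_comm])
    (by rwa [symmDiff_comm])
  have hmid : (1 / 2 : ℝ) • chi G M1 + (1 / 2 : ℝ) • chi G M2 =
      (1 / 2 : ℝ) • chi G (M1 ∆ A) + (1 / 2 : ℝ) • chi G (M2 ∆ A) := by
    funext e
    have := @hA e
    simp only [Pi.add_apply, Pi.smul_apply, smul_eq_mul, chi, Set.mem_symmDiff] at this ⊢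
    by_cases e1 : (e : Sym2 V) ∈ M1 <;> by_cases e2 : (e : Sym2 V) ∈ M2 <;>
      by_cases eA : (e : Sym2 V) ∈ A <;> simp [e1, e2, eA] at this ⊢
  have hin := hexp.isExtreme.left_mem_of_mem_openSegment (chi_mem G h3) (chi_mem G h4)
    (z := (1 / 2 : ℝ) • chi G M1 + (1 / 2 : ℝ) • chi G M2)
    ⟨1 / 2, 1 / 2, by norm_num, by norm_num, by norm_num, rfl⟩
    (by rw [hmid]; exact ⟨1 / 2, 1 / 2, by norm_num, by norm_num, by norm_num, rfl⟩)
  obtain ⟨a, b, ha, hb, hab, heq⟩ := hin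
  obtain ⟨e, he⟩ := hAne
  have hG : ∀ g ∈ M1 ∆ M2, g ∈ G.edgeSet := by
    rintro g (h | h)
    · exact h1.1 h.1
    · exact h2.1 h.1
  have q1 := congrFun heq ⟨e, hG e (hA he)⟩
  have q2 := congrFun heq ⟨f, hG f hf⟩
  have heD := hA he
  simp only [Pi.add_apply, Pi.smul_apply, smul_eq_mul, chi, Set.mem_symmDiff] at q1 q2 heD hf
  have r1 : a = 0 := by
    rcases heD with ⟨e1, e2⟩ | ⟨e2, e1⟩ <;> simp [e1, e2, he] at q1 <;> linarith
  have r2 : a = 1 := by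
    rcases hf with ⟨e1, e2⟩ | ⟨e2, e1⟩ <;> simp [e1, e2, hfA] at q2 <;> linarith
  linarith

lemma three_edges (G : SimpleGraph V) {M1 M2 : Set (Sym2 V)}
    (h1 : IsMatchingOf G M1) (h2 : IsMatchingOf G M2) {e f g : Sym2 V}
    (he : e ∈ M1 ∆ M2) (hf : f ∈ M1 ∆ M2) (hg : g ∈ M1 ∆ M2) {w : V}
    (we : w ∈ e) (wf : w ∈ f) (wg : w ∈ g) (hef : e ≠ f) (heg : e ≠ g) (hfg : f ≠ g) : False := by
  have a1 := fun h h' => h1.2 e h f h' hef w ⟨we, wf⟩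
  have a2 := fun h h' => h1.2 e h g h' heg w ⟨we, wg⟩
  have a3 := fun h h' => h1.2 f h g h' hfg w ⟨wf, wg⟩
  have b1 := fun h h' => h2.2 e h f h' hef w ⟨we, wf⟩
  have b2 := fun h h' => h2.2 e h g h' heg w ⟨we, wg⟩
  have b3 := fun h h' => h2.2 f h g h' hfg w ⟨wf, wg⟩
  rw [Set.mem_symmDiff] at he hf hg
  tauto

lemma interior_two (G : SimpleGraph V) {u v : V} (p : G.Walk u v) (hp : p.IsPath) {w : V}
    (hw : w ∈ p.support) (hu : w ≠ u) (hv : w ≠ v) :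
    ∃ f ∈ p.edges, ∃ g ∈ p.edges, f ≠ g ∧ w ∈ f ∧ w ∈ g := by
  induction p with
  | nil => simp at hw; exact absurd hw hu
  | @cons u u' v h q ih =>
    rw [SimpleGraph.Walk.cons_isPath_iff] at hp
    rw [SimpleGraph.Walk.support_cons, List.mem_cons] at hw
    have hw' := hw.resolve_left hu
    by_cases hwu : w = u'
    · subst hwu
      cases q with
      | nil => exact absurd rfl hv
      | @cons _ u'' _ h' q' =>
        refine ⟨s(u, w), by simp, s(w, u''), by simp, ?_, by simp, by simp⟩
        intro heq
        have hu'' : u = u'' := by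
          have : u ∈ s(w, u'') := heq ▸ Sym2.mem_mk_left u w
          rw [Sym2.mem_iff] at this
          exact this.resolve_left (Ne.symm hu)
        apply hp.2
        subst hu''
        simp
    · obtain ⟨f, hf, g, hg, hh⟩ := ih hp.1 hw' hwu hv
      exact ⟨f, by simp [hf], g, by simp [hg], hh⟩

lemma parity_aux (G : SimpleGraph V) {M1 M2 : Set (Sym2 V)}
    (h1 : IsMatchingOf G M1) (h2 : IsMatchingOf G M2) {u v : V} (q : G.Walk u v)
    (hq : q.IsPath) (hqD : ∀ e ∈ q.edges, e ∈ M1 ∆ M2) (e0 e1 : Sym2 V)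
    (he0 : e0 ∈ M1 ∆ M2) (he1 : e1 ∈ M1 ∆ M2) (hu : u ∈ e0) (hv : v ∈ e1)
    (hn0 : e0 ∉ q.edges) (hn1 : e1 ∉ q.edges) (hnil : q.length = 0 → e0 ≠ e1) :
    (e0 ∈ M1 ↔ e1 ∈ M1) ↔ Odd q.length := by
  have alt : ∀ e ∈ M1 ∆ M2, ∀ f ∈ M1 ∆ M2, e ≠ f → ∀ w, w ∈ e → w ∈ f →
      (e ∈ M1 ↔ f ∉ M1) := by
    intro e he f hf hef w we wf
    have a1 := fun h h' => h1.2 e h f h' hef w ⟨we, wf⟩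
    have b1 := fun h h' => h2.2 e h f h' hef w ⟨we, wf⟩
    rw [Set.mem_symmDiff] at he hf
    tauto
  induction q generalizing e0 with
  | nil =>
    have := alt e0 he0 e1 he1 (hnil rfl) _ hu hv
    simp
    tauto
  | @cons u u' v h q ih =>
    rw [SimpleGraph.Walk.cons_isPath_iff] at hq
    have hd : s(u, u') ∈ M1 ∆ M2 := hqD _ (by simp)
    have hne : e0 ≠ s(u, u') := fun h => hn0 (by simp [h])
    have a := alt e0 he0 _ hd hne u hu (by simp)
    have hnq : s(u, u') ∉ q.edges := fun hh => hq.2 (q.fst_mem_support_of_mem_edges hh)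
    have b := ih hq.1 (fun e he => hqD e (by simp [he])) s(u, u') hd (by simp) hv hnq
      (fun hh => hn1 (by simp [hh])) (fun _ hh => hn1 (by simp [← hh]))
    rw [SimpleGraph.Walk.length_cons, Nat.odd_add_one]
    tauto

lemma path_of_exposed (G : SimpleGraph V) [Fintype V] [Fintype G.edgeSet] (M1 M2 : Set (Sym2 V))
    (h1 : IsMatchingOf G M1) (h2 : IsMatchingOf G M2) (hne : M1 ≠ M2)
    (hexp : IsExposed ℝ (matchingPolyhedron G) (segment ℝ (chi G M1) (chi G M2))) :
    IsPathOrEvenCycleEdgeSet G (M1 ∆ M2) := by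
  have hG : ∀ g ∈ M1 ∆ M2, g ∈ G.edgeSet := by
    rintro g (h | h)
    · exact h1.1 h.1
    · exact h2.1 h.1
  let P : ℕ → Prop := fun n => ∃ (u v : V) (p : G.Walk u v), p.IsPath ∧
    (∀ e ∈ p.edges, e ∈ M1 ∆ M2) ∧ p.length = n
  have hbd : ∀ n, P n → n ≤ Fintype.card V := by
    rintro n ⟨u, v, p, hp, -, rfl⟩
    exact hp.length_lt.le
  have hP1 : P 1 := by
    obtain ⟨e, he⟩ : (M1 ∆ M2).Nonempty := by
      rw [Set.nonempty_iff_ne_empty]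
      exact fun h => hne (symmDiff_eq_bot.1 h)
    induction e using Sym2.ind with
    | _ a b =>
      have hab : G.Adj a b := hG _ he
      exact ⟨a, b, SimpleGraph.Walk.cons hab .nil, by simp [hab.ne], by simpa using he, by simp⟩
  set n := Nat.findGreatest P (Fintype.card V) with hn
  have hPn : P n := Nat.findGreatest_spec (hbd 1 hP1) hP1
  have hn1 : 1 ≤ n := Nat.le_findGreatest (hbd 1 hP1) hP1
  have hmax : ∀ m, P m → m ≤ n := fun m hm => Nat.le_findGreatest (hbd m hm) hm
  obtain ⟨u, v, p, hp, hpD, hlen⟩ := hPn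
  have hpne : ∃ e, e ∈ p.edges := by
    apply List.exists_mem_of_length_pos
    rw [SimpleGraph.Walk.length_edges]; omega
  -- interior vertices are saturated
  have hint : ∀ f ∈ M1 ∆ M2, f ∉ p.edges → ∀ w ∈ p.support, w ∈ f → w = u ∨ w = v := by
    intro f hf hfp w hw hwf
    by_contra hcon
    push Not at hcon
    obtain ⟨a, ha, b, hb, hab, wa, wb⟩ := interior_two G p hp hw hcon.1 hcon.2
    exact three_edges G h1 h2 hf (hpD a ha) (hpD b hb) hwf wa wb
      (fun h => hfp (h ▸ ha)) (fun h => hfp (h ▸ hb)) hab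
  have hsup : ∀ e ∈ p.edges, ∀ w ∈ e, w ∈ p.support := by
    intro e he w hw
    exact p.mem_support_of_mem_edges he hw
  -- an edge at an end closes up the path
  have hstart : ∀ w, s(w, u) ∈ M1 ∆ M2 → s(w, u) ∉ p.edges → w = v := by
    intro w hf hfp
    have hadj : G.Adj w u := hG _ hf
    by_cases hw : w ∈ p.support
    · exact (hint _ hf hfp w hw (by simp)).resolve_left hadj.ne
    · exfalso
      have := hmax (n + 1) ⟨w, v, SimpleGraph.Walk.cons hadj p, by simp [hp, hw], by
        intro e he
        rw [SimpleGraph.Walk.edges_cons, List.mem_cons] at he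
        rcases he with rfl | he
        · exact hf
        · exact hpD e he, by simp [hlen]⟩
      omega
  have hend : ∀ w, s(w, v) ∈ M1 ∆ M2 → s(w, v) ∉ p.edges → w = u := by
    intro w hf hfp
    have hadj : G.Adj w v := hG _ hf
    by_cases hw : w ∈ p.support
    · exact (hint _ hf hfp w hw (by simp)).resolve_right hadj.ne
    · exfalso
      have := hmax (n + 1) ⟨w, u, SimpleGraph.Walk.cons hadj p.reverse, by simp [hp, hw], by
        intro e he
        rw [SimpleGraph.Walk.edges_cons, List.mem_cons] at he
        rcases he with rfl | he
        · exact hf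
        · exact hpD e (by simpa using he), by simp [hlen]⟩
      omega
  have htouch : ∀ f ∈ M1 ∆ M2, f ∉ p.edges → ∀ w ∈ p.support, w ∈ f → f = s(v, u) := by
    intro f hf hfp w hw hwf
    obtain ⟨z, rfl⟩ := hwf
    rcases hint _ hf hfp w hw (by simp) with rfl | rfl
    · rw [Sym2.eq_swap] at hf hfp ⊢
      rw [hstart z hf hfp]
    · rw [Sym2.eq_swap] at hf hfp
      rw [hend z hf hfp]
  by_cases hc : s(v, u) ∈ M1 ∆ M2 ∧ s(v, u) ∉ p.edges
  · obtain ⟨hcD, hcp⟩ := hc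
    have hadj : G.Adj v u := hG _ hcD
    refine ⟨v, v, SimpleGraph.Walk.cons hadj p, Or.inr ⟨rfl, ?_, ?_⟩, ?_⟩
    · rw [SimpleGraph.Walk.copy_rfl_rfl, SimpleGraph.Walk.cons_isCycle_iff]
      exact ⟨hp, hcp⟩
    · have := parity_aux G h1 h2 p hp hpD s(v, u) s(v, u) hcD hcD (by simp) (by simp) hcp hcp
        (fun h => by omega)
      rw [SimpleGraph.Walk.length_cons, Nat.even_add_one, Nat.not_even_iff_odd]
      exact this.1 Iff.rfl
    · apply closed_part_eq G h1 h2 hexp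
      · intro e he
        rw [Set.mem_ofPred_eq, SimpleGraph.Walk.edges_cons, List.mem_cons] at he
        rcases he with rfl | he
        · exact hcD
        · exact hpD e he
      · exact ⟨s(v, u), by simp⟩
      · intro e he f hf w hwe hwf
        rw [Set.mem_ofPred_eq, SimpleGraph.Walk.edges_cons, List.mem_cons] at he ⊢
        by_cases hfp : f ∈ p.edges
        · exact Or.inr hfp
        left
        refine htouch f hf hfp w ?_ hwf
        rcases he with rfl | he
        · rw [Sym2.mem_iff] at hwe
          rcases hwe with rfl | rfl <;> simp
        · exact hsup e he w hwe
  · refine ⟨u, v, p, Or.inl ⟨hp, by omega⟩, ?_⟩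
    apply closed_part_eq G h1 h2 hexp hpD hpne
    intro e he f hf w hwe hwf
    by_contra hfp
    have := htouch f hf hfp w (hsup e he w hwe) hwf
    exact hc ⟨this ▸ hf, this ▸ hfp⟩

/-- `χ_{M1}` and `χ_{M2}` are adjacent vertices of the matching polyhedron
(the segment between them is an exposed face) iff `M1 ∆ M2` is the edge set of a simple
path or of a simple cycle of even length. -/
theorem adjacent_iff_symmDiff_path_or_evenCycle [Fintype V] [DecidableEq V]
    (G : SimpleGraph V) [DecidableRel G.Adj] (M1 M2 : Set (Sym2 V))
    (h1 : IsMatchingOf G M1) (h2 : IsMatchingOf G M2) (hne : M1 ≠ M2) :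
    IsExposed ℝ (matchingPolyhedron G) (segment ℝ (chi G M1) (chi G M2)) ↔
      IsPathOrEvenCycleEdgeSet G (M1 ∆ M2) := by
  exact ⟨path_of_exposed G M1 M2 h1 h2 hne, exposed_of_path G M1 M2 h1 h2 hne⟩
end
end
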